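/- For any morphism g: B ⟶ C in C, Q(g) is an isomorphism in D if and only if g belongs to S_N. -/

import Mathlib

open CategoryTheory CategoryTheory.Limits CategoryTheory.Pretriangulated

universe v u v₂ u₂

variable {C : Type u} [Category.{v} C] [Preadditive C] [HasZeroObject C]
  [HasShift C ℤ] [∀ n : ℤ, (shiftFunctor C n).Additive] [Pretriangulated C]

/-- `f : X ⟶ Y` factors through an object of `N`. -/
def FactorsThru (N : Set C) {X Y : C} (f : X ⟶ Y) : Prop :=
  ∃ (Z : C) (_ : Z ∈ N) (u : X ⟶ Z) (v : Z ⟶ Y), f = u ≫ v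

/-- The morphism `X⟦-1⟧ ⟶ A` obtained from `h : X ⟶ A⟦1⟧` by shifting by `-1` and
composing with the canonical isomorphism `A⟦1⟧⟦-1⟧ ≅ A`. -/
noncomputable def descShift {X A : C} (h : X ⟶ A⟦(1:ℤ)⟧) : X⟦(-1:ℤ)⟧ ⟶ A :=
  h⟦(-1:ℤ)⟧' ≫ (shiftEquiv C (1:ℤ)).unitIso.inv.app A

/-- The class `S_N` of morphisms fitting in a distinguished triangle whose two other
maps factor through `N`. -/
def SN (N : Set C) {B C₀ : C} (g : B ⟶ C₀) : Prop :=
  ∃ (A : C) (f : A ⟶ B) (h : C₀ ⟶ A⟦(1:ℤ)⟧),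
    (Triangle.mk f g h ∈ distTriang C) ∧ FactorsThru N f ∧ FactorsThru N h

/-- The class `L`. -/
def ClassL (N : Set C) {A B : C} (f : A ⟶ B) : Prop :=
  ∃ (N₀ : C) (_ : N₀ ∈ N) (g : B ⟶ N₀) (h : N₀ ⟶ A⟦(1:ℤ)⟧),
    (Triangle.mk f g h ∈ distTriang C) ∧ FactorsThru N (descShift h)

/-- The class `R`. -/
def ClassR (N : Set C) {B C₀ : C} (g : B ⟶ C₀) : Prop :=
  ∃ (N₀ : C) (_ : N₀ ∈ N) (f : N₀ ⟶ B) (h : C₀ ⟶ N₀⟦(1:ℤ)⟧),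
    (Triangle.mk f g h ∈ distTriang C) ∧ FactorsThru N h

/-- Condition (Lex) on a morphism `h : C₀ ⟶ A⟦1⟧`. -/
def LexCond (N : Set C) {C₀ A : C} (h : C₀ ⟶ A⟦(1:ℤ)⟧) : Prop :=
  ∀ (N₀ : C), N₀ ∈ N → ∀ (x : N₀ ⟶ C₀), FactorsThru N (descShift (x ≫ h))

/-- Condition (Rex) on a morphism `h : C₀ ⟶ A⟦1⟧`. -/
def RexCond (N : Set C) {C₀ A : C} (h : C₀ ⟶ A⟦(1:ℤ)⟧) : Prop :=
  ∀ (N₀ : C), N₀ ∈ N → ∀ (y : A ⟶ N₀),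
    ∃ (M : C) (_ : M ∈ N) (u : C₀⟦(-1:ℤ)⟧ ⟶ M⟦(-1:ℤ)⟧) (v : M⟦(-1:ℤ)⟧ ⟶ N₀),
      descShift h ≫ y = u ≫ v

/-- `S_N` as a morphism property. -/
def SNProp (N : Set C) : MorphismProperty C := fun _ _ g => SN N g


section Ideal

variable {N : Set C}

omit [Preadditive C] [HasZeroObject C] [HasShift C ℤ]
  [∀ n : ℤ, (shiftFunctor C n).Additive] [Pretriangulated C] in
lemma FactorsThru.precomp {W X Y : C} (w : W ⟶ X) {f : X ⟶ Y} (hf : FactorsThru N f) :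
    FactorsThru N (w ≫ f) := by
  obtain ⟨Z, hZ, u, v, rfl⟩ := hf
  exact ⟨Z, hZ, w ≫ u, v, (Category.assoc _ _ _).symm⟩

omit [Preadditive C] [HasZeroObject C] [HasShift C ℤ]
  [∀ n : ℤ, (shiftFunctor C n).Additive] [Pretriangulated C] in
lemma FactorsThru.postcomp {X Y Z : C} {f : X ⟶ Y} (hf : FactorsThru N f) (w : Y ⟶ Z) :
    FactorsThru N (f ≫ w) := by
  obtain ⟨Z, hZ, u, v, rfl⟩ := hf
  exact ⟨Z, hZ, u, v ≫ w, Category.assoc _ _ _⟩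

omit [HasZeroObject C] [HasShift C ℤ] [∀ n : ℤ, (shiftFunctor C n).Additive]
  [Pretriangulated C] in
lemma FactorsThru.neg {X Y : C} {f : X ⟶ Y} (hf : FactorsThru N f) : FactorsThru N (-f) := by
  obtain ⟨Z, hZ, u, v, rfl⟩ := hf
  exact ⟨Z, hZ, -u, v, by simp⟩

omit [Preadditive C] [HasZeroObject C] [HasShift C ℤ]
  [∀ n : ℤ, (shiftFunctor C n).Additive] [Pretriangulated C] in
lemma FactorsThru.of_comp_left {X Y Z : C} (hZ : Z ∈ N) (u : X ⟶ Z) (v : Z ⟶ Y) :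
    FactorsThru N (u ≫ v) := ⟨Z, hZ, u, v, rfl⟩

omit [HasShift C ℤ] [∀ n : ℤ, (shiftFunctor C n).Additive] [Pretriangulated C] in
lemma FactorsThru.zero (hN0 : ∀ X : C, Limits.IsZero X → X ∈ N) (X Y : C) :
    FactorsThru N (0 : X ⟶ Y) :=
  ⟨_, hN0 _ (isZero_zero C), 0, 0, by simp⟩

lemma FactorsThru.add
    (hNext : ∀ (T : Triangle C), (T ∈ distTriang C) → T.obj₁ ∈ N → T.obj₃ ∈ N → T.obj₂ ∈ N)
    {X Y : C} {f g : X ⟶ Y} (hf : FactorsThru N f) (hg : FactorsThru N g) :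
    FactorsThru N (f + g) := by
  obtain ⟨Z, hZ, u, v, rfl⟩ := hf
  obtain ⟨Z', hZ', u', v', rfl⟩ := hg
  exact ⟨Z ⊞ Z', hNext _ (binaryBiproductTriangle_distinguished Z Z') hZ hZ',
    biprod.lift u u', biprod.desc v v', by simp⟩

end Ideal

section Triangles

lemma exists_extension {X Y Z W : C} {f : X ⟶ Y} {g : Y ⟶ Z} {h : Z ⟶ X⟦(1 : ℤ)⟧}
    (hT : Triangle.mk f g h ∈ distTriang C) (a : X ⟶ W) (ha : h ≫ a⟦(1 : ℤ)⟧' = 0) :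
    ∃ b : Y ⟶ W, f ≫ b = a := by
  obtain ⟨b, hb, -⟩ := complete_distinguished_triangle_morphism₂ _ _ hT
    (contractible_distinguished W) a 0 (ha.trans zero_comp.symm)
  exact ⟨b, hb.trans (Category.comp_id a)⟩

lemma exists_lift {X Y Z W : C} {f : X ⟶ Y} {g : Y ⟶ Z} {h : Z ⟶ X⟦(1 : ℤ)⟧}
    (hT : Triangle.mk f g h ∈ distTriang C) (a : W ⟶ Z) (ha : a ≫ h = 0) :
    ∃ b : W ⟶ Y, b ≫ g = a := by
  obtain ⟨b, hb⟩ := Triangle.coyoneda_exact₃ _ hT a ha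
  exact ⟨b, hb.symm⟩

lemma exists_factor_left {X Y Z W : C} {f : X ⟶ Y} {g : Y ⟶ Z} {h : Z ⟶ X⟦(1 : ℤ)⟧}
    (hT : Triangle.mk f g h ∈ distTriang C) (a : W ⟶ Y) (ha : a ≫ g = 0) :
    ∃ b : W ⟶ X, b ≫ f = a := by
  obtain ⟨b, hb⟩ := Triangle.coyoneda_exact₂ _ hT a ha
  exact ⟨b, hb.symm⟩

lemma exists_factor_right {X Y Z W : C} {f : X ⟶ Y} {g : Y ⟶ Z} {h : Z ⟶ X⟦(1 : ℤ)⟧}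
    (hT : Triangle.mk f g h ∈ distTriang C) (a : Y ⟶ W) (ha : f ≫ a = 0) :
    ∃ b : Z ⟶ W, g ≫ b = a := by
  obtain ⟨b, hb⟩ := Triangle.yoneda_exact₂ _ hT a ha
  exact ⟨b, hb.symm⟩

lemma exists_shift_factor {X Y Z W : C} {f : X ⟶ Y} {g : Y ⟶ Z} {h : Z ⟶ X⟦(1 : ℤ)⟧}
    (hT : Triangle.mk f g h ∈ distTriang C) (a : Z ⟶ W) (ha : g ≫ a = 0) :
    ∃ b : X⟦(1 : ℤ)⟧ ⟶ W, h ≫ b = a := by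
  obtain ⟨b, hb⟩ := Triangle.yoneda_exact₃ _ hT a ha
  exact ⟨b, hb.symm⟩

lemma exists_shift_lift {X Y Z W : C} {f : X ⟶ Y} {g : Y ⟶ Z} {h : Z ⟶ X⟦(1 : ℤ)⟧}
    (hT : Triangle.mk f g h ∈ distTriang C) (a : W ⟶ X⟦(1 : ℤ)⟧) (ha : a ≫ f⟦(1 : ℤ)⟧' = 0) :
    ∃ b : W ⟶ Z, b ≫ h = a := by
  obtain ⟨b, hb⟩ := Triangle.coyoneda_exact₁ _ hT a ha
  exact ⟨b, hb.symm⟩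

lemma exists_triangle_hom₂ {X Y Z X' Y' Z' : C} {f : X ⟶ Y} {g : Y ⟶ Z}
    {h : Z ⟶ X⟦(1 : ℤ)⟧} {f' : X' ⟶ Y'} {g' : Y' ⟶ Z'} {h' : Z' ⟶ X'⟦(1 : ℤ)⟧}
    (hT : Triangle.mk f g h ∈ distTriang C) (hT' : Triangle.mk f' g' h' ∈ distTriang C)
    (a : X ⟶ X') (c : Z ⟶ Z') (comm : h ≫ a⟦(1 : ℤ)⟧' = c ≫ h') :
    ∃ b : Y ⟶ Y', f ≫ b = a ≫ f' ∧ g ≫ c = b ≫ g' :=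
  complete_distinguished_triangle_morphism₂ _ _ hT hT' a c comm

lemma rotate_mem {X Y Z : C} {f : X ⟶ Y} {g : Y ⟶ Z} {h : Z ⟶ X⟦(1 : ℤ)⟧}
    (hT : Triangle.mk f g h ∈ distTriang C) :
    Triangle.mk g h (-f⟦(1 : ℤ)⟧') ∈ distTriang C :=
  rot_of_distTriang _ hT

lemma comp_mor₁_mor₂_eq_zero {X Y Z : C} {f : X ⟶ Y} {g : Y ⟶ Z} {h : Z ⟶ X⟦(1 : ℤ)⟧}
    (hT : Triangle.mk f g h ∈ distTriang C) : f ≫ g = 0 :=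
  comp_distTriang_mor_zero₁₂ _ hT

lemma comp_mor₂_mor₃_eq_zero {X Y Z : C} {f : X ⟶ Y} {g : Y ⟶ Z} {h : Z ⟶ X⟦(1 : ℤ)⟧}
    (hT : Triangle.mk f g h ∈ distTriang C) : g ≫ h = 0 :=
  comp_distTriang_mor_zero₂₃ _ hT

lemma comp_mor₃_mor₁_shift_eq_zero {X Y Z : C} {f : X ⟶ Y} {g : Y ⟶ Z} {h : Z ⟶ X⟦(1 : ℤ)⟧}
    (hT : Triangle.mk f g h ∈ distTriang C) : h ≫ f⟦(1 : ℤ)⟧' = 0 :=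
  comp_distTriang_mor_zero₃₁ _ hT

end Triangles

section SN

variable {N : Set C}

/-- Morphisms of `S_N` are monomorphisms modulo the ideal of morphisms factoring through `N`. -/
lemma SN.factorsThru_of_comp {X B C₀ : C} {s : B ⟶ C₀} (hs : SN N s) {f : X ⟶ B}
    (hNext : ∀ (T : Triangle C), (T ∈ distTriang C) → T.obj₁ ∈ N → T.obj₃ ∈ N → T.obj₂ ∈ N)
    (hf : FactorsThru N (f ≫ s)) : FactorsThru N f := by
  obtain ⟨A, k, h, hT, ⟨N₀, hN₀, u, v, rfl⟩, -⟩ := hs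
  obtain ⟨M, hM, a, b, hab⟩ := hf
  have hsh : s ≫ h = 0 := comp_mor₂_mor₃_eq_zero hT
  have hshift : h ≫ (u ≫ v)⟦(1 : ℤ)⟧' = 0 := comp_mor₃_mor₁_shift_eq_zero hT
  obtain ⟨E, i, p, hE⟩ := distinguished_cocone_triangle₂ (b ≫ h)
  obtain ⟨E', i', p', hE'⟩ := distinguished_cocone_triangle₂ (b ≫ h ≫ u⟦(1 : ℤ)⟧')
  have hE'N : E' ∈ N := hNext _ hE' hN₀ hM
  obtain ⟨q, hq₁, hq₂⟩ := exists_triangle_hom₂ hE hT (𝟙 A) b (by simp)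
  obtain ⟨e, he⟩ := exists_lift hE a (by rw [← Category.assoc, ← hab, Category.assoc, hsh,
    comp_zero])
  obtain ⟨k, hk, -⟩ := exists_triangle_hom₂ hE hE' u (𝟙 M) (by simp)
  obtain ⟨w, hw⟩ := exists_extension hE' v (by
    simpa only [Category.assoc, ← Functor.map_comp] using! by rw [hshift, comp_zero])
  obtain ⟨c, hc⟩ := exists_factor_right hE (q - k ≫ w) (by
    rw [Preadditive.comp_sub, hq₁, reassoc_of% hk, hw]; simp)
  have hqN : FactorsThru N q := by
    rw [← sub_add_cancel q (k ≫ w), ← hc]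
    exact (FactorsThru.of_comp_left hM _ _).add hNext (.of_comp_left hE'N _ _)
  obtain ⟨d, hd⟩ := exists_factor_left hT (f - e ≫ q) (by
    rw [Preadditive.sub_comp, Category.assoc, ← hq₂, reassoc_of% he, hab, sub_self])
  rw [← sub_add_cancel f (e ≫ q), ← hd]
  exact (FactorsThru.precomp _ (.of_comp_left hN₀ u v)).add hNext (hqN.precomp e)

/-- Morphisms of `S_N` are epimorphisms modulo the ideal of morphisms factoring through `N`. -/
lemma SN.factorsThru_of_comp' {B C₀ Y : C} {s : B ⟶ C₀} (hs : SN N s) {f : C₀ ⟶ Y}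
    (hNext : ∀ (T : Triangle C), (T ∈ distTriang C) → T.obj₁ ∈ N → T.obj₃ ∈ N → T.obj₂ ∈ N)
    (hf : FactorsThru N (s ≫ f)) : FactorsThru N f := by
  obtain ⟨A, k, h, hT, -, ⟨N₁, hN₁, c, j, rfl⟩⟩ := hs
  obtain ⟨M, hM, a, b, hab⟩ := hf
  have hks : k ≫ s = 0 := comp_mor₁_mor₂_eq_zero hT
  have hshift : (c ≫ j) ≫ k⟦(1 : ℤ)⟧' = 0 := comp_mor₃_mor₁_shift_eq_zero hT
  obtain ⟨E, i, p, hE⟩ := distinguished_cocone_triangle₂ ((k ≫ a)⟦(1 : ℤ)⟧')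
  obtain ⟨E', i', p', hE'⟩ := distinguished_cocone_triangle₂ (j ≫ (k ≫ a)⟦(1 : ℤ)⟧')
  have hE'N : E' ∈ N := hNext _ hE' hM hN₁
  obtain ⟨q, hq₁, hq₂⟩ := exists_triangle_hom₂ (rotate_mem hT) hE a (-𝟙 _) (by simp)
  obtain ⟨e, he⟩ := exists_extension hE b (by
    rw [← Functor.map_comp, Category.assoc, ← hab, reassoc_of% hks, zero_comp, Functor.map_zero])
  obtain ⟨r, -, hr⟩ := exists_triangle_hom₂ hE' hE (𝟙 M) j (by simp)
  obtain ⟨w, hw⟩ := exists_lift hE' c (by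
    rw [Functor.map_comp, ← Category.assoc, ← Category.assoc, hshift, zero_comp])
  obtain ⟨d, hd⟩ := exists_factor_left hE (q + w ≫ r) (by
    rw [Preadditive.add_comp, ← hq₂, Category.assoc w, ← hr, reassoc_of% hw]; simp)
  have hqN : FactorsThru N q := by
    rw [← add_sub_cancel_right q (w ≫ r), ← hd, sub_eq_add_neg]
    exact (FactorsThru.of_comp_left hM _ _).add hNext (FactorsThru.of_comp_left hE'N _ _).neg
  obtain ⟨z, hz⟩ := exists_shift_factor hT (f - q ≫ e) (by
    rw [Preadditive.comp_sub, reassoc_of% hq₁, he, hab, sub_self])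
  rw [← sub_add_cancel f (q ≫ e), ← hz, Category.assoc]
  exact (FactorsThru.of_comp_left hN₁ _ _).add hNext (hqN.postcomp e)

/-- The right Ore condition for `S_N` modulo the ideal of morphisms factoring through `N`. -/
lemma SN.exists_ore {X B C₀ : C} {s : B ⟶ C₀} (hs : SN N s) (g : X ⟶ C₀)
    (hNext : ∀ (T : Triangle C), (T ∈ distTriang C) → T.obj₁ ∈ N → T.obj₃ ∈ N → T.obj₂ ∈ N) :
    ∃ (E : C) (t : E ⟶ X) (q : E ⟶ B), SN N t ∧ FactorsThru N (t ≫ g - q ≫ s) := by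
  obtain ⟨A, k, h, hT, ⟨M, hM, u, v, rfl⟩, ⟨N₁, hN₁, c, j, rfl⟩⟩ := hs
  have hshift : (c ≫ j) ≫ (u ≫ v)⟦(1 : ℤ)⟧' = 0 := comp_mor₃_mor₁_shift_eq_zero hT
  obtain ⟨E, i, t, hE⟩ := distinguished_cocone_triangle₂ (g ≫ c ≫ j ≫ u⟦(1 : ℤ)⟧')
  obtain ⟨L', i', p', hL'⟩ := distinguished_cocone_triangle₂ (j ≫ u⟦(1 : ℤ)⟧')
  obtain ⟨L, l, p, hL⟩ := distinguished_cocone_triangle₂ (u⟦(1 : ℤ)⟧')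
  have hL'N : L' ∈ N := hNext _ hL' hM hN₁
  obtain ⟨x, -, hx⟩ := exists_triangle_hom₂ hE hL' (𝟙 M) (g ≫ c) (by simp)
  obtain ⟨y, -, hy⟩ := exists_triangle_hom₂ hL' hL (𝟙 M) j (by simp)
  obtain ⟨w, hw⟩ := exists_shift_lift hT p (by
    rw [Functor.map_comp, reassoc_of% (comp_mor₂_mor₃_eq_zero hL), zero_comp])
  obtain ⟨q, hq⟩ := exists_lift hT (t ≫ g - (x ≫ y) ≫ w) (by
    rw [Preadditive.sub_comp, Category.assoc, Category.assoc, Category.assoc, hw, ← hy,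
      ← reassoc_of% hx, sub_self])
  refine ⟨E, t, q, ⟨M, i, _, hE, ⟨M, hM, 𝟙 _, i, by simp⟩,
    ⟨N₁, hN₁, g ≫ c, j ≫ u⟦(1 : ℤ)⟧', by simp⟩⟩, ?_⟩
  rw [hq, sub_sub_cancel, Category.assoc]
  exact .of_comp_left hL'N x (y ≫ w)

end SN

section Kernel

variable (N : Set C)

/-- The relation identifying morphisms whose difference factors through `N`. -/
def idealRel : HomRel C := fun _ _ f g => FactorsThru N (f - g)

variable {N}

lemma idealRel.congruence (hN0 : ∀ X : C, Limits.IsZero X → X ∈ N)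
    (hNext : ∀ (T : Triangle C), (T ∈ distTriang C) → T.obj₁ ∈ N → T.obj₃ ∈ N → T.obj₂ ∈ N) :
    Congruence (idealRel N) where
  comp_left f g g' h := by
    simpa only [idealRel, Preadditive.comp_sub] using FactorsThru.precomp f h
  comp_right g h := by
    simpa only [idealRel, Preadditive.sub_comp] using FactorsThru.postcomp h g
  equivalence :=
    { refl := fun f => by simpa only [idealRel, sub_self] using FactorsThru.zero hN0 _ _
      symm := fun h => by simpa only [idealRel, neg_sub] using FactorsThru.neg h
      trans := fun h h' => by
        simpa only [idealRel, sub_add_sub_cancel] using FactorsThru.add hNext h h' }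

variable (N) in
/-- The multiplicative closure of the image of `S_N` in the ideal quotient of `C` by `N`. -/
def quotientSN : MorphismProperty (Quotient (idealRel N)) :=
  ((SNProp N).strictMap (Quotient.functor (idealRel N))).multiplicativeClosure

lemma quotientSN_map {X Y : C} {s : X ⟶ Y} (hs : SN N s) :
    quotientSN N ((Quotient.functor (idealRel N)).map s) :=
  .of _ (.map hs)

instance : (quotientSN N).IsMultiplicative :=
  inferInstanceAs (MorphismProperty.multiplicativeClosure _).IsMultiplicative

lemma quotientSN_le_monomorphisms (hN0 : ∀ X : C, Limits.IsZero X → X ∈ N)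
    (hNext : ∀ (T : Triangle C), (T ∈ distTriang C) → T.obj₁ ∈ N → T.obj₃ ∈ N → T.obj₂ ∈ N) :
    quotientSN N ≤ MorphismProperty.monomorphisms _ := by
  have := idealRel.congruence hN0 hNext
  rw [quotientSN, MorphismProperty.multiplicativeClosure_le_iff]
  rintro _ _ _ ⟨hs⟩
  refine ⟨fun {Z} f g h => ?_⟩
  obtain ⟨Z⟩ := Z
  obtain ⟨f, rfl⟩ := (Quotient.functor (idealRel N)).map_surjective (X := Z) f
  obtain ⟨g, rfl⟩ := (Quotient.functor (idealRel N)).map_surjective (X := Z) g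
  rw [← Functor.map_comp, ← Functor.map_comp, Quotient.functor_map_eq_iff, idealRel,
    ← Preadditive.sub_comp] at h
  exact CategoryTheory.Quotient.sound _ (hs.factorsThru_of_comp hNext h)

lemma quotientSN_le_epimorphisms (hN0 : ∀ X : C, Limits.IsZero X → X ∈ N)
    (hNext : ∀ (T : Triangle C), (T ∈ distTriang C) → T.obj₁ ∈ N → T.obj₃ ∈ N → T.obj₂ ∈ N) :
    quotientSN N ≤ MorphismProperty.epimorphisms _ := by
  have := idealRel.congruence hN0 hNext
  rw [quotientSN, MorphismProperty.multiplicativeClosure_le_iff]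
  rintro _ _ _ ⟨hs⟩
  refine ⟨fun {Z} f g h => ?_⟩
  obtain ⟨Z⟩ := Z
  obtain ⟨f, rfl⟩ := (Quotient.functor (idealRel N)).map_surjective (Y := Z) f
  obtain ⟨g, rfl⟩ := (Quotient.functor (idealRel N)).map_surjective (Y := Z) g
  rw [← Functor.map_comp, ← Functor.map_comp, Quotient.functor_map_eq_iff, idealRel,
    ← Preadditive.comp_sub] at h
  exact CategoryTheory.Quotient.sound _ (hs.factorsThru_of_comp' hNext h)

lemma quotientSN_exists_ore
    (hNext : ∀ (T : Triangle C), (T ∈ distTriang C) → T.obj₁ ∈ N → T.obj₃ ∈ N → T.obj₂ ∈ N)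
    {Y Z : Quotient (idealRel N)} {s : Y ⟶ Z} (hs : quotientSN N s)
    {X : Quotient (idealRel N)} (f : X ⟶ Z) :
    ∃ (X' : Quotient (idealRel N)) (t : X' ⟶ X) (q : X' ⟶ Y),
      quotientSN N t ∧ t ≫ f = q ≫ s := by
  have key {B C₀ : C} {s : B ⟶ C₀} (hs : SN N s) {X : Quotient (idealRel N)}
      (f : X ⟶ (Quotient.functor (idealRel N)).obj C₀) :
      ∃ (X' : Quotient (idealRel N)) (t : X' ⟶ X)
        (q : X' ⟶ (Quotient.functor (idealRel N)).obj B),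
        quotientSN N t ∧ t ≫ f = q ≫ (Quotient.functor (idealRel N)).map s := by
    obtain ⟨X⟩ := X
    obtain ⟨f, rfl⟩ := (Quotient.functor (idealRel N)).map_surjective (X := X) f
    obtain ⟨E, t, q, ht, h⟩ := hs.exists_ore f hNext
    refine ⟨_, (Quotient.functor _).map t, (Quotient.functor _).map q, quotientSN_map ht, ?_⟩
    rw [← Functor.map_comp, ← Functor.map_comp]
    exact CategoryTheory.Quotient.sound _ h
  induction hs generalizing X with
  | of _ hs =>
    obtain ⟨hs⟩ := hs
    exact key hs f
  | id _ => exact ⟨X, 𝟙 X, f, .id X, by simp⟩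
  | comp_of s s' _ hs' ih =>
    obtain ⟨hs'⟩ := hs'
    obtain ⟨X', t, q, ht, h⟩ := key hs' f
    obtain ⟨X'', t', q', ht', h'⟩ := ih q
    exact ⟨X'', t' ≫ t, q', (quotientSN N).comp_mem _ _ ht' ht, by
      rw [Category.assoc, h, reassoc_of% h']⟩

lemma quotientSN_hasRightCalculusOfFractions (hN0 : ∀ X : C, Limits.IsZero X → X ∈ N)
    (hNext : ∀ (T : Triangle C), (T ∈ distTriang C) → T.obj₁ ∈ N → T.obj₃ ∈ N → T.obj₂ ∈ N) :
    (quotientSN N).HasRightCalculusOfFractions where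
  exists_rightFraction X Y φ := by
    obtain ⟨X', t, q, ht, h⟩ := quotientSN_exists_ore hNext φ.hs φ.f
    exact ⟨⟨t, ht, q⟩, h⟩
  ext X Y Y' f₁ f₂ s hs h := by
    have : Mono s := quotientSN_le_monomorphisms hN0 hNext s hs
    exact ⟨X, 𝟙 X, .id X, by rw [(cancel_mono s).1 h]⟩

/-- A morphism killed by the localization at `S_N` factors through `N`. -/
lemma factorsThru_of_map_eq_zero (hN0 : ∀ X : C, Limits.IsZero X → X ∈ N)
    (hNext : ∀ (T : Triangle C), (T ∈ distTriang C) → T.obj₁ ∈ N → T.obj₃ ∈ N → T.obj₂ ∈ N)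
    {D : Type u₂} [Category.{v₂} D] [Preadditive D] (Q : C ⥤ D) [Q.Additive]
    [Q.IsLocalization (SNProp N)] {X Y : C} {f : X ⟶ Y} (hf : Q.map f = 0) :
    FactorsThru N f := by
  have := idealRel.congruence hN0 hNext
  have := quotientSN_hasRightCalculusOfFractions hN0 hNext
  let F := Quotient.functor (idealRel N) ⋙ (quotientSN N).Q
  have hF : (SNProp N).IsInvertedBy F := fun _ _ s hs =>
    Localization.inverts (quotientSN N).Q (quotientSN N) _ (quotientSN_map hs)
  have hzero : F.map f = F.map 0 := by
    rw [← NatIso.naturality_1 (Localization.fac F hF Q) f,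
      ← NatIso.naturality_1 (Localization.fac F hF Q) 0, Functor.comp_map, Functor.comp_map, hf,
      Q.map_zero]
  obtain ⟨Z, t, ht, h⟩ :=
    (MorphismProperty.map_eq_iff_precomp (quotientSN N).Q (quotientSN N) _ _).1 hzero
  have : Epi t := quotientSN_le_epimorphisms hN0 hNext t ht
  have h' := (Quotient.functor_map_eq_iff _ _ _).1 ((cancel_epi t).1 h)
  simpa only [idealRel, sub_zero] using h'

end Kernel

theorem stmt12 (N : Set C)
    (hN0 : ∀ X : C, Limits.IsZero X → X ∈ N)
    (hNiso : ∀ ⦃X Y : C⦄, (X ≅ Y) → X ∈ N → Y ∈ N)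
    (hNsum : ∀ ⦃X Z : C⦄ (i : X ⟶ Z) (r : Z ⟶ X), i ≫ r = 𝟙 X → Z ∈ N → X ∈ N)
    (hNext : ∀ (T : Triangle C), (T ∈ distTriang C) → T.obj₁ ∈ N → T.obj₃ ∈ N → T.obj₂ ∈ N)
    {D : Type u₂} [Category.{v₂} D] [Preadditive D] [HasZeroObject D]
    (Q : C ⥤ D) [Q.Additive] [Q.IsLocalization (SNProp N)]
    {B C₀ : C} (g : B ⟶ C₀) :
    IsIso (Q.map g) ↔ SN N g := by
  refine ⟨fun hg => ?_, fun hg => Localization.inverts Q (SNProp N) g hg⟩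
  obtain ⟨A, f, h, hT⟩ := distinguished_cocone_triangle₁ g
  refine ⟨A, f, h, hT, factorsThru_of_map_eq_zero hN0 hNext Q ?_,
    factorsThru_of_map_eq_zero hN0 hNext Q ?_⟩
  · rw [← cancel_mono (Q.map g), ← Q.map_comp, comp_mor₁_mor₂_eq_zero hT, Q.map_zero, zero_comp]
  · rw [← cancel_epi (Q.map g), ← Q.map_comp, comp_mor₂_mor₃_eq_zero hT, Q.map_zero, comp_zero]
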